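/- arXiv:math/0502079 — 3 statements merged into one kernel-verified Lean document; each statement's English description precedes it below -/
import Mathlib

section
/- Let u be a smooth positive solution of the heat equation on all of ℝⁿ × ℝ that is bounded above (i.e., there exists M > 0 with 0 < u ≤ M everywhere). Then u is constant. (Corollary of Theorem 1.2(a) in the Euclidean case.) -/
open Metric Set

/-- Spatial gradient of a function on Euclidean space. -/
noncomputable def sgrad {n : ℕ} (f : EuclideanSpace ℝ (Fin n) → ℝ)
    (x : EuclideanSpace ℝ (Fin n)) : EuclideanSpace ℝ (Fin n) :=
  gradient f x

/-- Spatial Laplacian: sum of the second partial derivatives. -/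
noncomputable def slap {n : ℕ} (f : EuclideanSpace ℝ (Fin n) → ℝ)
    (x : EuclideanSpace ℝ (Fin n)) : ℝ :=
  ∑ i : Fin n, fderiv ℝ (fun y => fderiv ℝ f y (EuclideanSpace.single i 1)) x
    (EuclideanSpace.single i 1)

/-- `u(x,t)` is a (smooth) solution of the heat equation on `Q`. -/
def IsHeatSolutionOn {n : ℕ} (u : EuclideanSpace ℝ (Fin n) → ℝ → ℝ)
    (Q : Set (EuclideanSpace ℝ (Fin n) × ℝ)) : Prop :=
  ContDiffOn ℝ (⊤ : ℕ∞) (fun p : EuclideanSpace ℝ (Fin n) × ℝ => u p.1 p.2) Q ∧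
  ∀ p ∈ Q, deriv (fun s => u p.1 s) p.2 = slap (fun y => u y p.2) p.1

open Filter Topology

/-- A twice differentiable function has nonpositive second derivative at a local maximum. -/
theorem IsLocalMax.second_deriv_nonpos {f g : ℝ → ℝ} {a d : ℝ} (hmax : IsLocalMax f a)
    (hf : ∀ s, HasDerivAt f (g s) s) (hg : HasDerivAt g d a) : d ≤ 0 := by
  by_contra! hd
  have hfg : deriv f = g := funext fun s => (hf s).deriv
  have hmin : IsLocalMin f a :=
    isLocalMin_of_deriv_deriv_pos (by rwa [hfg, hg.deriv]) hmax.deriv_eq_zero (hf a).continuousAt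
  have hconst : f =ᶠ[𝓝 a] fun _ => f a := by
    filter_upwards [hmax, hmin] with s h₁ h₂ using le_antisymm h₁ h₂
  have hzero : g =ᶠ[𝓝 a] fun _ => 0 := by
    have := hconst.deriv
    rw [hfg] at this
    simpa using this
  have := hzero.deriv_eq
  rw [hg.deriv, deriv_const] at this
  exact hd.ne' this

/-- A derivative is nonnegative at a point which maximizes the function over a left interval. -/
theorem HasDerivAt.nonneg_of_forall_le_left {f : ℝ → ℝ} {a c d : ℝ} (hf : HasDerivAt f d a)
    (hc : c < a) (hmax : ∀ s, c < s → s < a → f s ≤ f a) : 0 ≤ d := by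
  have hlim : Tendsto (slope f a) (𝓝[<] a) (𝓝 d) :=
    (hasDerivAt_iff_tendsto_slope.mp hf).mono_left
      (nhdsWithin_mono _ fun s (hs : s < a) => hs.ne)
  refine ge_of_tendsto hlim ?_
  filter_upwards [Ioo_mem_nhdsLT hc] with s hs
  rw [slope_def_field]
  exact div_nonneg_of_nonpos (sub_nonpos.2 (hmax s hs.1 hs.2)) (sub_nonpos.2 hs.2.le)

/-- The second derivatives of `v` along the coordinate axes exist, and their sum is the time
derivative of `v`. -/
def HasHeatDerivs {n : ℕ} (v : EuclideanSpace ℝ (Fin n) → ℝ → ℝ) : Prop :=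
  ∀ y t, ∃ (g : Fin n → ℝ → ℝ) (D : Fin n → ℝ),
    (∀ j s, HasDerivAt (fun r : ℝ => v (y + r • EuclideanSpace.single j 1) t) (g j s) s) ∧
    (∀ j, HasDerivAt (g j) (D j) 0) ∧ HasDerivAt (fun s => v y s) (∑ j, D j) t

theorem HasHeatDerivs.neg {n : ℕ} {v : EuclideanSpace ℝ (Fin n) → ℝ → ℝ} (hv : HasHeatDerivs v) :
    HasHeatDerivs fun y t => -v y t := by
  intro y t
  obtain ⟨g, D, hg, hD, ht⟩ := hv y t
  refine ⟨fun j s => -g j s, fun j => -D j, fun j s => (hg j s).neg, fun j => (hD j).neg, ?_⟩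
  rw [Finset.sum_neg_distrib]
  exact ht.neg

/-- A supersolution of the heat equation on the half cylinder `0 ≤ y i`, `‖y‖ ≤ R`,
`-R ^ 2 ≤ t ≤ 0`. -/
noncomputable def heatBarrier {n : ℕ} (i : Fin n) (M R : ℝ) (y : EuclideanSpace ℝ (Fin n))
    (t : ℝ) : ℝ :=
  M * ((‖y‖ ^ 2 - t) / R ^ 2 + (n + 1) * (2 * (y i / R) - (y i / R) ^ 2))

theorem heatBarrier_add_smul_single {n : ℕ} (i j : Fin n) (M R : ℝ)
    (y : EuclideanSpace ℝ (Fin n)) (t : ℝ) :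
    ∃ b : ℝ, ∀ s : ℝ, heatBarrier i M R (y + s • EuclideanSpace.single j 1) t =
      heatBarrier i M R y t + b * s +
        (M / R ^ 2 * (1 - (n + 1) * if i = j then 1 else 0)) * s ^ 2 := by
  refine ⟨M * (2 * y j / R ^ 2 +
    (n + 1) * (2 / R - 2 * y i / R ^ 2) * if i = j then 1 else 0), fun s => ?_⟩
  have hnorm : ‖y + s • EuclideanSpace.single j (1 : ℝ)‖ ^ 2 = ‖y‖ ^ 2 + 2 * s * y j + s ^ 2 := by
    rw [norm_add_sq_real, norm_smul, inner_smul_right, EuclideanSpace.inner_single_right]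
    simp
    ring
  unfold heatBarrier
  rw [hnorm]
  by_cases h : i = j
  · subst h
    simp
    ring
  · simp [h]
    ring

/-- Comparison with the barrier on a half cylinder. -/
theorem HasHeatDerivs.le_heatBarrier {n : ℕ} {v : EuclideanSpace ℝ (Fin n) → ℝ → ℝ}
    (hv : HasHeatDerivs v) (hcont : Continuous fun p : EuclideanSpace ℝ (Fin n) × ℝ => v p.1 p.2)
    {i : Fin n} {M R : ℝ} (hM : 0 < M) (hR : 0 < R) (hle : ∀ y t, v y t ≤ M)
    (hzero : ∀ y t, y i = 0 → v y t ≤ 0) {y : EuclideanSpace ℝ (Fin n)} (hy : 0 ≤ y i)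
    (hyR : ‖y‖ ≤ R) : v y 0 ≤ heatBarrier i M R y 0 := by
  let K : Set (EuclideanSpace ℝ (Fin n) × ℝ) :=
    (closedBall 0 R ∩ {z | 0 ≤ z i}) ×ˢ Icc (-R ^ 2) 0
  have hK : IsCompact K := by
    refine IsCompact.prod ((isCompact_closedBall _ _).inter_right ?_) isCompact_Icc
    exact isClosed_le continuous_const (by fun_prop)
  have hyK : (y, (0 : ℝ)) ∈ K := by
    simp [K, hy, hyR, sq_nonneg]
  have hwc : Continuous fun p : EuclideanSpace ℝ (Fin n) × ℝ =>
      v p.1 p.2 - heatBarrier i M R p.1 p.2 := by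
    unfold heatBarrier
    fun_prop
  obtain ⟨⟨z, t⟩, hzK, hmax⟩ := hK.exists_isMaxOn ⟨_, hyK⟩ hwc.continuousOn
  have hmax' : ∀ z' t', (z', t') ∈ K →
      v z' t' - heatBarrier i M R z' t' ≤ v z t - heatBarrier i M R z t :=
    fun z' t' h => hmax h
  by_contra! hlt
  have hpos : heatBarrier i M R z t < v z t := by
    have := hmax' _ _ hyK
    linarith
  obtain ⟨⟨hzR, hzi⟩, ht₁, ht₂⟩ := hzK
  simp only [mem_closedBall, dist_zero_right, mem_ofPred_eq] at hzR hzi ht₁ ht₂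
  have hziR : z i / R ≤ 1 := by
    rw [div_le_one hR]
    exact (le_abs_self _).trans ((PiLp.norm_apply_le z i).trans hzR)
  have hziR₀ : 0 ≤ z i / R := by positivity
  have hconc : 0 ≤ ((n : ℝ) + 1) * (2 * (z i / R) - (z i / R) ^ 2) :=
    mul_nonneg (by positivity) (by nlinarith)
  have hR2 : 0 < R ^ 2 := by positivity
  have hsmall : ‖z‖ ^ 2 - t < R ^ 2 := by
    by_contra! h
    have h1 : 1 ≤ (‖z‖ ^ 2 - t) / R ^ 2 := (one_le_div hR2).2 h
    have : M * 1 ≤ heatBarrier i M R z t :=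
      mul_le_mul_of_nonneg_left (by linarith) hM.le
    linarith [hle z t]
  have hzi' : 0 < z i := by
    refine lt_of_le_of_ne hzi fun h => ?_
    have : 0 ≤ heatBarrier i M R z t :=
      mul_nonneg hM.le (add_nonneg (div_nonneg (by nlinarith [sq_nonneg ‖z‖]) hR2.le) hconc)
    linarith [hzero z t h.symm]
  have hzR' : ‖z‖ < R := by
    nlinarith [norm_nonneg z]
  have ht' : -R ^ 2 < t := by nlinarith [sq_nonneg ‖z‖]
  obtain ⟨g, D, hg, hD, htime⟩ := hv z t
  have hspace : ∀ j, D j ≤ 2 * (M / R ^ 2 * (1 - (n + 1) * if i = j then 1 else 0)) := by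
    intro j
    obtain ⟨b, hb⟩ := heatBarrier_add_smul_single i j M R z t
    set c := M / R ^ 2 * (1 - ((n : ℝ) + 1) * if i = j then 1 else 0)
    have hloc : IsLocalMax (fun s : ℝ => v (z + s • EuclideanSpace.single j 1) t -
        (heatBarrier i M R z t + b * s + c * s ^ 2)) 0 := by
      have hline : Continuous fun s : ℝ => z + s • EuclideanSpace.single j (1 : ℝ) := by fun_prop
      have h₁ : ∀ᶠ s : ℝ in 𝓝 0, ‖z + s • EuclideanSpace.single j (1 : ℝ)‖ < R :=
        hline.norm.continuousAt.eventually_lt continuousAt_const (by simpa using hzR')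
      have h₂ : ∀ᶠ s : ℝ in 𝓝 0, 0 < (z + s • EuclideanSpace.single j (1 : ℝ)) i :=
        continuousAt_const.eventually_lt
          (g := fun s : ℝ => (z + s • EuclideanSpace.single j (1 : ℝ)) i)
          (by fun_prop) (by simpa using hzi')
      filter_upwards [h₁, h₂] with s hs₁ hs₂
      rw [← hb]
      have := hmax' (z + s • EuclideanSpace.single j 1) t
        ⟨⟨by simpa using hs₁.le, hs₂.le⟩, ht₁, ht₂⟩
      simpa using this
    have hderiv : ∀ s, HasDerivAt (fun s : ℝ => v (z + s • EuclideanSpace.single j 1) t -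
        (heatBarrier i M R z t + b * s + c * s ^ 2)) (g j s - (b + c * (2 * s))) s := by
      intro s
      refine (hg j s).sub ?_
      have := (((hasDerivAt_id s).const_mul b).const_add (heatBarrier i M R z t)).add
        (((hasDerivAt_id s).pow 2).const_mul c)
      exact this.congr_deriv (by simp)
    have hderiv₂ : HasDerivAt (fun s => g j s - (b + c * (2 * s))) (D j - 2 * c) 0 := by
      refine (hD j).sub ?_
      have := (((hasDerivAt_id (0 : ℝ)).const_mul 2).const_mul c).const_add b
      exact this.congr_deriv (by ring)
    linarith [hloc.second_deriv_nonpos hderiv hderiv₂]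
  have hsum : ∑ j, D j ≤ -2 * (M / R ^ 2) := by
    refine (Finset.sum_le_sum fun j _ => hspace j).trans_eq ?_
    rw [← Finset.mul_sum, ← Finset.mul_sum, Finset.sum_sub_distrib, ← Finset.mul_sum]
    simp
  have htime' : HasDerivAt (fun s => v z s - heatBarrier i M R z s) (∑ j, D j + M / R ^ 2) t := by
    have hbar : HasDerivAt (fun s => heatBarrier i M R z s) (-(M / R ^ 2)) t := by
      have := ((((hasDerivAt_id t).const_sub (‖z‖ ^ 2)).div_const (R ^ 2)).add_const
        (((n : ℝ) + 1) * (2 * (z i / R) - (z i / R) ^ 2))).const_mul M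
      exact this.congr_deriv (by ring)
    exact (htime.sub hbar).congr_deriv (by ring)
  have := htime'.nonneg_of_forall_le_left ht' fun s hs₁ hs₂ =>
    hmax' z s ⟨⟨by simpa using hzR, hzi⟩, hs₁.le, hs₂.le.trans ht₂⟩
  have : 0 < M / R ^ 2 := by positivity
  linarith

/-- An eternal solution on a half space which is bounded above and nonpositive on the boundary is
nonpositive. -/
theorem HasHeatDerivs.nonpos {n : ℕ} {v : EuclideanSpace ℝ (Fin n) → ℝ → ℝ}
    (hv : HasHeatDerivs v) (hcont : Continuous fun p : EuclideanSpace ℝ (Fin n) × ℝ => v p.1 p.2)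
    {i : Fin n} {M : ℝ} (hM : 0 < M) (hle : ∀ y t, v y t ≤ M)
    (hzero : ∀ y t, y i = 0 → v y t ≤ 0) {y : EuclideanSpace ℝ (Fin n)} (hy : 0 ≤ y i) :
    v y 0 ≤ 0 := by
  have hlim : Tendsto (fun R => heatBarrier i M R y 0) atTop (𝓝 0) := by
    have h₁ : Tendsto (fun R : ℝ => y i / R) atTop (𝓝 0) := tendsto_const_nhds.div_atTop tendsto_id
    have h₂ : Tendsto (fun R : ℝ => (‖y‖ ^ 2 - 0) / R ^ 2) atTop (𝓝 0) :=
      tendsto_const_nhds.div_atTop (tendsto_pow_atTop two_ne_zero)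
    have := (h₂.add (((h₁.const_mul 2).sub (h₁.pow 2)).const_mul ((n : ℝ) + 1))).const_mul M
    simpa [heatBarrier] using this
  refine ge_of_tendsto hlim ?_
  filter_upwards [eventually_ge_atTop ‖y‖, eventually_gt_atTop 0] with R hR hR₀
  exact hv.le_heatBarrier hcont hM hR₀ hle hzero hy hR

/-- Reflection of `y` in the hyperplane `y i = 0`. -/
noncomputable def coordReflection {n : ℕ} (i : Fin n) (y : EuclideanSpace ℝ (Fin n)) :
    EuclideanSpace ℝ (Fin n) :=
  y - (2 * y i) • EuclideanSpace.single i 1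

theorem coordReflection_add_smul_single {n : ℕ} (i j : Fin n) (y : EuclideanSpace ℝ (Fin n))
    (s : ℝ) : coordReflection i (y + s • EuclideanSpace.single j 1) =
      coordReflection i y + ((if i = j then -1 else 1) * s) • EuclideanSpace.single j 1 := by
  unfold coordReflection
  by_cases h : i = j
  · subst h
    simp
    module
  · simp [h]
    module

theorem hasDerivAt_comp_line {E : Type*} [NormedAddCommGroup E] [NormedSpace ℝ E] {f : E → ℝ}
    (hf : Differentiable ℝ f) (z e : E) (σ s : ℝ) :
    HasDerivAt (fun r : ℝ => f (z + (σ * r) • e)) (σ * fderiv ℝ f (z + (σ * s) • e) e) s := by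
  have hline : HasDerivAt (fun r : ℝ => z + (σ * r) • e) (σ • e) s := by
    simpa using (((hasDerivAt_id s).const_mul σ).smul_const e).const_add z
  exact ((hf _).hasFDerivAt.comp_hasDerivAt s hline).congr_deriv (by simp)

section HeatSolution

variable {n : ℕ} {u : EuclideanSpace ℝ (Fin n) → ℝ → ℝ}

theorem IsHeatSolutionOn.contDiff (hu : IsHeatSolutionOn u univ) :
    ContDiff ℝ (⊤ : ℕ∞) fun p : EuclideanSpace ℝ (Fin n) × ℝ => u p.1 p.2 :=
  contDiffOn_univ.1 hu.1

theorem IsHeatSolutionOn.contDiff_space (hu : IsHeatSolutionOn u univ) (t : ℝ) :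
    ContDiff ℝ (⊤ : ℕ∞) fun y => u y t :=
  hu.contDiff.comp (contDiff_id.prodMk contDiff_const)

theorem IsHeatSolutionOn.hasDerivAt_time (hu : IsHeatSolutionOn u univ)
    (x : EuclideanSpace ℝ (Fin n)) (t : ℝ) :
    HasDerivAt (fun s => u x s) (slap (fun y => u y t) x) t := by
  have h : ContDiff ℝ (⊤ : ℕ∞) fun s => u x s :=
    hu.contDiff.comp (contDiff_const.prodMk contDiff_id)
  rw [← hu.2 (x, t) (mem_univ _)]
  exact (h.differentiable (by simp) t).hasDerivAt

theorem IsHeatSolutionOn.hasHeatDerivs_sub_reflection (hu : IsHeatSolutionOn u univ) (i : Fin n)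
    (x : EuclideanSpace ℝ (Fin n)) (t₀ : ℝ) :
    HasHeatDerivs fun y t => u (x + y) (t₀ + t) - u (x + coordReflection i y) (t₀ + t) := by
  intro y t
  set f := fun y => u y (t₀ + t)
  have hf : ContDiff ℝ (⊤ : ℕ∞) f := hu.contDiff_space _
  have hfd : Differentiable ℝ f := hf.differentiable (by simp)
  let e : Fin n → EuclideanSpace ℝ (Fin n) := fun j => EuclideanSpace.single j 1
  have hfd₂ : ∀ j, Differentiable ℝ fun z => fderiv ℝ f z (e j) := fun j =>
    ((hf.fderiv_right (m := 1) (by norm_cast)).clm_apply contDiff_const).differentiable one_ne_zero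
  let σ : Fin n → ℝ := fun j => if i = j then -1 else 1
  have hσ : ∀ j, σ j * σ j = 1 := fun j => by by_cases h : i = j <;> simp [σ, h]
  refine ⟨fun j s => 1 * fderiv ℝ f (x + y + (1 * s) • e j) (e j) -
      σ j * fderiv ℝ f (x + coordReflection i y + (σ j * s) • e j) (e j),
    fun j => fderiv ℝ (fun z => fderiv ℝ f z (e j)) (x + y) (e j) -
      fderiv ℝ (fun z => fderiv ℝ f z (e j)) (x + coordReflection i y) (e j), ?_, ?_, ?_⟩
  · intro j s
    have := (hasDerivAt_comp_line hfd (x + y) (e j) 1 s).sub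
      (hasDerivAt_comp_line hfd (x + coordReflection i y) (e j) (σ j) s)
    refine this.congr_of_eventuallyEq (Eventually.of_forall fun r => ?_)
    simp [f, e, σ, coordReflection_add_smul_single, add_assoc]
  · intro j
    have := ((hasDerivAt_comp_line (hfd₂ j) (x + y) (e j) 1 0).const_mul 1).sub
      ((hasDerivAt_comp_line (hfd₂ j) (x + coordReflection i y) (e j) (σ j) 0).const_mul (σ j))
    refine this.congr_deriv ?_
    rw [← mul_assoc (σ j), hσ]
    simp
  · rw [Finset.sum_sub_distrib]
    exact ((hu.hasDerivAt_time (x + y) (t₀ + t)).comp_const_add t₀ t).sub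
      ((hu.hasDerivAt_time (x + coordReflection i y) (t₀ + t)).comp_const_add t₀ t)

theorem IsHeatSolutionOn.reflection_eq (hu : IsHeatSolutionOn u univ) {M : ℝ} (hM : 0 < M)
    (hbd : ∀ x t, 0 < u x t ∧ u x t ≤ M) (i : Fin n) (x y : EuclideanSpace ℝ (Fin n)) (t : ℝ)
    (hy : 0 ≤ y i) : u (x + y) t = u (x + coordReflection i y) t := by
  have hcont : Continuous fun p : EuclideanSpace ℝ (Fin n) × ℝ =>
      u (x + p.1) (t + p.2) - u (x + coordReflection i p.1) (t + p.2) := by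
    have h := hu.contDiff.continuous
    have hrefl : Continuous (coordReflection i) := by
      unfold coordReflection
      fun_prop
    exact (h.comp (f := fun p : EuclideanSpace ℝ (Fin n) × ℝ => (x + p.1, t + p.2))
      (by fun_prop)).sub
      (h.comp (f := fun p : EuclideanSpace ℝ (Fin n) × ℝ => (x + coordReflection i p.1, t + p.2))
        (by fun_prop))
  have hderivs := hu.hasHeatDerivs_sub_reflection i x t
  have hle := hderivs.nonpos hcont hM
    (fun y s => by linarith [(hbd (x + y) (t + s)).2, (hbd (x + coordReflection i y) (t + s)).1])
    (fun y s h => by simp [coordReflection, h]) hy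
  have hge := hderivs.neg.nonpos hcont.neg hM
    (fun y s => by linarith [(hbd (x + y) (t + s)).1, (hbd (x + coordReflection i y) (t + s)).2])
    (fun y s h => by simp [coordReflection, h]) hy
  simp only [add_zero] at hle hge
  linarith

/-- A bounded eternal solution is invariant under translations along the coordinate axes. -/
theorem IsHeatSolutionOn.add_smul_single_eq (hu : IsHeatSolutionOn u univ) {M : ℝ} (hM : 0 < M)
    (hbd : ∀ x t, 0 < u x t ∧ u x t ≤ M) (i : Fin n) (x : EuclideanSpace ℝ (Fin n)) (t s : ℝ) :
    u (x + s • EuclideanSpace.single i 1) t = u x t := by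
  have hnonneg : ∀ x : EuclideanSpace ℝ (Fin n), ∀ s : ℝ, 0 ≤ s →
      u (x + s • EuclideanSpace.single i 1) t = u x t := by
    intro x s hs
    have h := hu.reflection_eq hM hbd i (x + (s / 2) • EuclideanSpace.single i 1)
      ((s / 2) • EuclideanSpace.single i 1) t (by simpa using div_nonneg hs zero_le_two)
    convert h using 2
    · module
    · simp [coordReflection]
      module
  rcases le_total 0 s with hs | hs
  · exact hnonneg x s hs
  · have h := hnonneg (x + s • EuclideanSpace.single i 1) (-s) (neg_nonneg.2 hs)
    rw [← h]
    congr 1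
    module

end HeatSolution

/-- Corollary of Theorem 1.2(a): bounded positive eternal solutions are constant. -/
theorem liouville_heat_bounded (n : ℕ) (hn : 1 ≤ n)
    (u : EuclideanSpace ℝ (Fin n) → ℝ → ℝ)
    (hsol : IsHeatSolutionOn u univ)
    (M : ℝ) (hM : 0 < M)
    (hbd : ∀ (x : EuclideanSpace ℝ (Fin n)) (t : ℝ), 0 < u x t ∧ u x t ≤ M) :
    ∃ C : ℝ, ∀ (x : EuclideanSpace ℝ (Fin n)) (t : ℝ), u x t = C := by
  have hpartial : ∀ t x i, fderiv ℝ (fun y => u y t) x (EuclideanSpace.single i 1) = 0 := by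
    intro t x i
    have hdiff := (hsol.contDiff_space t).differentiable (by simp)
    have := hasDerivAt_comp_line hdiff x (EuclideanSpace.single i 1) 1 0
    simp only [hsol.add_smul_single_eq hM hbd] at this
    simpa using this.unique (hasDerivAt_const _ _)
  have hspace : ∀ t x, u x t = u 0 t := by
    intro t x
    refine is_const_of_fderiv_eq_zero (𝕜 := ℝ) (f := fun y => u y t)
      ((hsol.contDiff_space t).differentiable (by simp)) (fun z => ?_) x 0
    refine ContinuousLinearMap.coe_injective
      ((EuclideanSpace.basisFun (Fin n) ℝ).toBasis.ext fun i => ?_)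
    simpa using hpartial t z i
  have htime : ∀ t, HasDerivAt (fun s => u 0 s) 0 t := by
    intro t
    simpa [slap, hpartial] using hsol.hasDerivAt_time 0 t
  refine ⟨u 0 0, fun x t => (hspace t x).trans ?_⟩
  exact is_const_of_deriv_eq_zero (fun s => (htime s).differentiableAt) (fun s => (htime s).deriv)
    t 0
end

section
/- Let f be a smooth real-valued function on an open set Q ⊂ ℝⁿ × ℝ satisfying Δf + |∇f|² − ∂_t f = 0 and f < 1 on Q, and set w := |∇f|²/(1−f)². Then on Q one has the identity Δw − ∂_t w = 2‖∇²f‖²/(1−f)² + 6|∇f|⁴/(1−f)⁴ + 8⟨∇²f ∇f, ∇f⟩/(1−f)³ − 4⟨∇²f ∇f, ∇f⟩/(1−f)² − 2|∇f|⁴/(1−f)³, where ∇²f is the spatial Hessian of f, ‖∇²f‖² = Σ_{i,j} (∂_i∂_j f)² is its squared Frobenius norm, and ⟨∇²f ∇f, ∇f⟩ = Σ_{i,j} ∂_i f (∂_i∂_j f) ∂_j f. (The identity following (2.5), in the flat case where the Bochner curvature term vanishes.) -/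
open Metric Set

/-- Spatial Hessian entries: `∂_i ∂_j f`. -/
noncomputable def shess {n : ℕ} (f : EuclideanSpace ℝ (Fin n) → ℝ)
    (x : EuclideanSpace ℝ (Fin n)) (i j : Fin n) : ℝ :=
  fderiv ℝ (fun y => fderiv ℝ f y (EuclideanSpace.single j 1)) x (EuclideanSpace.single i 1)

section DirectionalDerivative

variable {V : Type*} [NormedAddCommGroup V] [NormedSpace ℝ V]

/-- The derivative of `F` in the constant direction `v`, as a function of the base point. -/
noncomputable def dirDeriv (v : V) (F : V → ℝ) (p : V) : ℝ :=
  fderiv ℝ F p v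

theorem dirDeriv_congr {Q : Set V} (hQ : IsOpen Q) {F G : V → ℝ} (h : EqOn F G Q) (v : V) :
    EqOn (dirDeriv v F) (dirDeriv v G) Q := fun p hp => by
  have : F =ᶠ[nhds p] G := h.eventuallyEq_of_mem (hQ.mem_nhds hp)
  simp only [dirDeriv, this.fderiv_eq]

theorem ContDiffOn.dirDeriv {Q : Set V} (hQ : IsOpen Q) {F : V → ℝ}
    (hF : ContDiffOn ℝ (⊤ : ℕ∞) F Q) (v : V) : ContDiffOn ℝ (⊤ : ℕ∞) (dirDeriv v F) Q :=
  (hF.fderiv_of_isOpen hQ (by simp)).clm_apply contDiffOn_const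

theorem ContDiffOn.differentiableAt_of_isOpen {Q : Set V} (hQ : IsOpen Q) {F : V → ℝ}
    (hF : ContDiffOn ℝ (⊤ : ℕ∞) F Q) {p : V} (hp : p ∈ Q) : DifferentiableAt ℝ F p :=
  (hF.contDiffAt (hQ.mem_nhds hp)).differentiableAt (by simp)

theorem dirDeriv_comm {Q : Set V} (hQ : IsOpen Q) {F : V → ℝ}
    (hF : ContDiffOn ℝ (⊤ : ℕ∞) F Q) (u v : V) :
    EqOn (dirDeriv u (dirDeriv v F)) (dirDeriv v (dirDeriv u F)) Q := fun p hp => by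
  have hd : DifferentiableAt ℝ (fderiv ℝ F) p :=
    ((hF.fderiv_of_isOpen (m := (⊤ : ℕ∞)) hQ (by simp)).contDiffAt
      (hQ.mem_nhds hp)).differentiableAt (by simp)
  have hsymm : IsSymmSndFDerivAt ℝ F p :=
    (hF.contDiffAt (hQ.mem_nhds hp)).isSymmSndFDerivAt (by
      rw [minSmoothness_of_isRCLikeNormedField]
      exact WithTop.coe_le_coe.2 (le_top (a := (2 : ℕ∞))))
  have happly (a b : V) : dirDeriv a (dirDeriv b F) p = fderiv ℝ (fderiv ℝ F) p a b := by
    change fderiv ℝ (fun q => fderiv ℝ F q b) p a = _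
    rw [fderiv_clm_apply hd (differentiableAt_const b)]
    simp
  rw [happly, happly, hsymm.eq]

theorem dirDeriv_add {F G : V → ℝ} {p : V} (hF : DifferentiableAt ℝ F p)
    (hG : DifferentiableAt ℝ G p) (v : V) :
    dirDeriv v (fun q => F q + G q) p = dirDeriv v F p + dirDeriv v G p := by
  simp [dirDeriv, fderiv_fun_add hF hG]

theorem dirDeriv_mul {F G : V → ℝ} {p : V} (hF : DifferentiableAt ℝ F p)
    (hG : DifferentiableAt ℝ G p) (v : V) :
    dirDeriv v (fun q => F q * G q) p = dirDeriv v F p * G p + F p * dirDeriv v G p := by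
  simp [dirDeriv, fderiv_fun_mul hF hG]
  ring

theorem dirDeriv_const_mul {F : V → ℝ} {p : V} (hF : DifferentiableAt ℝ F p) (c : ℝ) (v : V) :
    dirDeriv v (fun q => c * F q) p = c * dirDeriv v F p := by
  simp [dirDeriv, fderiv_const_mul hF]

theorem dirDeriv_pow {F : V → ℝ} {p : V} (hF : DifferentiableAt ℝ F p) (k : ℕ) (v : V) :
    dirDeriv v (fun q => F q ^ k) p = k * F p ^ (k - 1) * dirDeriv v F p := by
  simp [dirDeriv, fderiv_fun_pow k hF]

theorem dirDeriv_sum {ι : Type*} [Fintype ι] {F : ι → V → ℝ} {p : V}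
    (hF : ∀ i, DifferentiableAt ℝ (F i) p) (v : V) :
    dirDeriv v (fun q => ∑ i, F i q) p = ∑ i, dirDeriv v (F i) p := by
  simp [dirDeriv, fderiv_fun_sum fun i _ => hF i]

theorem dirDeriv_inv_one_sub {F : V → ℝ} {p : V} (hF : DifferentiableAt ℝ F p)
    (hp : 1 - F p ≠ 0) (v : V) :
    dirDeriv v (fun q => (1 - F q)⁻¹) p = ((1 - F p)⁻¹) ^ 2 * dirDeriv v F p := by
  have h : fderiv ℝ (fun q => (1 - F q)⁻¹) p = _ :=
    ((hasDerivAt_inv hp).comp_hasFDerivAt p (hF.hasFDerivAt.const_sub 1)).fderiv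
  simp [dirDeriv, h]

end DirectionalDerivative

section Bochner

variable {V ι : Type*} [NormedAddCommGroup V] [NormedSpace ℝ V] [Fintype ι]

/-- The squared length of the gradient of `F` along the directions `e`. -/
noncomputable def gradSq (e : ι → V) (F : V → ℝ) (p : V) : ℝ :=
  ∑ j, dirDeriv (e j) F p ^ 2

theorem ContDiffOn.gradSq {Q : Set V} (hQ : IsOpen Q) {F : V → ℝ}
    (hF : ContDiffOn ℝ (⊤ : ℕ∞) F Q) (e : ι → V) : ContDiffOn ℝ (⊤ : ℕ∞) (gradSq e F) Q :=
  ContDiffOn.sum fun j _ => (hF.dirDeriv hQ (e j)).pow 2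

theorem dirDeriv_gradSq {Q : Set V} (hQ : IsOpen Q) {F : V → ℝ}
    (hF : ContDiffOn ℝ (⊤ : ℕ∞) F Q) (e : ι → V) (v : V) :
    EqOn (dirDeriv v (gradSq e F))
      (fun q => 2 * ∑ j, dirDeriv (e j) F q * dirDeriv v (dirDeriv (e j) F) q) Q := by
  intro p hp
  have hd (j : ι) := (hF.dirDeriv hQ (e j)).differentiableAt_of_isOpen hQ hp
  change dirDeriv v (fun q => ∑ j, dirDeriv (e j) F q ^ 2) p = _
  rw [dirDeriv_sum fun j => (hd j).fun_pow 2]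
  simp only [dirDeriv_pow (hd _), Finset.mul_sum]
  exact Finset.sum_congr rfl fun j _ => by push_cast; ring

theorem dirDeriv_dirDeriv_gradSq {Q : Set V} (hQ : IsOpen Q) {F : V → ℝ}
    (hF : ContDiffOn ℝ (⊤ : ℕ∞) F Q) (e : ι → V) (v : V) {p : V} (hp : p ∈ Q) :
    dirDeriv v (dirDeriv v (gradSq e F)) p =
      2 * ∑ j, (dirDeriv v (dirDeriv (e j) F) p ^ 2 +
        dirDeriv (e j) F p * dirDeriv (e j) (dirDeriv v (dirDeriv v F)) p) := by
  have hD (j : ι) := hF.dirDeriv hQ (e j)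
  have hd (j : ι) := (hD j).differentiableAt_of_isOpen hQ hp
  have hdd (j : ι) := ((hD j).dirDeriv hQ v).differentiableAt_of_isOpen hQ hp
  rw [dirDeriv_congr hQ (dirDeriv_gradSq hQ hF e v) v hp,
    dirDeriv_const_mul (DifferentiableAt.fun_sum fun j _ => (hd j).fun_mul (hdd j)),
    dirDeriv_sum fun j => (hd j).fun_mul (hdd j)]
  congr 1
  refine Finset.sum_congr rfl fun j _ => ?_
  rw [dirDeriv_mul (hd j) (hdd j), dirDeriv_congr hQ (dirDeriv_comm hQ hF v (e j)) v hp,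
    dirDeriv_comm hQ (hF.dirDeriv hQ v) v (e j) hp]
  ring

/-- First derivative of the quotient `G / (1 - F) ^ 2`. -/
theorem dirDeriv_mul_inv_one_sub_sq {F G : V → ℝ} {p : V} (hF : DifferentiableAt ℝ F p)
    (hG : DifferentiableAt ℝ G p) (hp : 1 - F p ≠ 0) (v : V) :
    dirDeriv v (fun q => G q * (1 - F q)⁻¹ ^ 2) p =
      dirDeriv v G p * (1 - F p)⁻¹ ^ 2 + 2 * (G p * dirDeriv v F p * (1 - F p)⁻¹ ^ 3) := by
  have hK : DifferentiableAt ℝ (fun q => (1 - F q)⁻¹) p := (hF.const_sub 1).fun_inv hp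
  rw [dirDeriv_mul hG (hK.fun_pow 2), dirDeriv_pow hK, dirDeriv_inv_one_sub hF hp]
  push_cast
  ring

/-- Second derivative of the quotient `G / (1 - F) ^ 2`. -/
theorem dirDeriv_dirDeriv_mul_inv_one_sub_sq {Q : Set V} (hQ : IsOpen Q) {F G : V → ℝ}
    (hF : ContDiffOn ℝ (⊤ : ℕ∞) F Q) (hG : ContDiffOn ℝ (⊤ : ℕ∞) G Q)
    (hne : ∀ p ∈ Q, 1 - F p ≠ 0) (v : V) {p : V} (hp : p ∈ Q) :
    dirDeriv v (dirDeriv v (fun q => G q * (1 - F q)⁻¹ ^ 2)) p =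
      dirDeriv v (dirDeriv v G) p * (1 - F p)⁻¹ ^ 2 +
      4 * (dirDeriv v G p * dirDeriv v F p) * (1 - F p)⁻¹ ^ 3 +
      2 * G p * (dirDeriv v (dirDeriv v F) p * (1 - F p)⁻¹ ^ 3 +
        3 * dirDeriv v F p ^ 2 * (1 - F p)⁻¹ ^ 4) := by
  have hfirst : EqOn (dirDeriv v (fun q => G q * (1 - F q)⁻¹ ^ 2))
      (fun q => dirDeriv v G q * (1 - F q)⁻¹ ^ 2 +
        2 * (G q * dirDeriv v F q * (1 - F q)⁻¹ ^ 3)) Q := fun q hq =>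
    dirDeriv_mul_inv_one_sub_sq (hF.differentiableAt_of_isOpen hQ hq)
      (hG.differentiableAt_of_isOpen hQ hq) (hne q hq) v
  have dF := hF.differentiableAt_of_isOpen hQ hp
  have dG := hG.differentiableAt_of_isOpen hQ hp
  have dDF := (hF.dirDeriv hQ v).differentiableAt_of_isOpen hQ hp
  have dDG := (hG.dirDeriv hQ v).differentiableAt_of_isOpen hQ hp
  have hK : DifferentiableAt ℝ (fun q => (1 - F q)⁻¹) p := (dF.const_sub 1).fun_inv (hne p hp)
  have dGF := dG.fun_mul dDF
  rw [dirDeriv_congr hQ hfirst v hp,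
    dirDeriv_add (dDG.fun_mul (hK.fun_pow 2)) ((dGF.fun_mul (hK.fun_pow 3)).const_mul 2),
    dirDeriv_mul_inv_one_sub_sq dF dDG (hne p hp),
    dirDeriv_const_mul (dGF.fun_mul (hK.fun_pow 3)), dirDeriv_mul dGF (hK.fun_pow 3),
    dirDeriv_mul dG dDF, dirDeriv_pow hK, dirDeriv_inv_one_sub dF (hne p hp)]
  push_cast
  ring

/-- The Bochner-type identity for `gradSq e F / (1 - F) ^ 2`, where `F` solves
`∑ i, ∂ᵢ∂ᵢ F + gradSq e F = ∂_τ F`, for arbitrary constant directions `e i` and `τ`. -/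
theorem bochner_identity_dirDeriv {Q : Set V} (hQ : IsOpen Q) {F : V → ℝ}
    (hF : ContDiffOn ℝ (⊤ : ℕ∞) F Q) (hne : ∀ p ∈ Q, 1 - F p ≠ 0) (e : ι → V) (τ : V)
    (heq : ∀ p ∈ Q, dirDeriv τ F p =
      ∑ i, dirDeriv (e i) (dirDeriv (e i) F) p + gradSq e F p) {p : V} (hp : p ∈ Q) :
    ∑ i, dirDeriv (e i) (dirDeriv (e i) (fun q => gradSq e F q * (1 - F q)⁻¹ ^ 2)) p -
        dirDeriv τ (fun q => gradSq e F q * (1 - F q)⁻¹ ^ 2) p =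
      2 * (∑ i, ∑ j, dirDeriv (e i) (dirDeriv (e j) F) p ^ 2) * (1 - F p)⁻¹ ^ 2 +
      6 * gradSq e F p ^ 2 * (1 - F p)⁻¹ ^ 4 +
      8 * (∑ i, ∑ j, dirDeriv (e i) F p * dirDeriv (e i) (dirDeriv (e j) F) p *
        dirDeriv (e j) F p) * (1 - F p)⁻¹ ^ 3 -
      4 * (∑ i, ∑ j, dirDeriv (e i) F p * dirDeriv (e i) (dirDeriv (e j) F) p *
        dirDeriv (e j) F p) * (1 - F p)⁻¹ ^ 2 -
      2 * gradSq e F p ^ 2 * (1 - F p)⁻¹ ^ 3 := by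
  have hG := hF.gradSq hQ e
  have dF := hF.differentiableAt_of_isOpen hQ hp
  have dG := hG.differentiableAt_of_isOpen hQ hp
  have dDD (i : ι) :=
    ((hF.dirDeriv hQ (e i)).dirDeriv hQ (e i)).differentiableAt_of_isOpen hQ hp
  set H := ∑ i, ∑ j, dirDeriv (e i) F p * dirDeriv (e i) (dirDeriv (e j) F) p *
    dirDeriv (e j) F p with hH
  have hcross : ∑ i, dirDeriv (e i) (gradSq e F) p * dirDeriv (e i) F p = 2 * H := by
    simp only [dirDeriv_gradSq hQ hF e _ hp, hH, Finset.mul_sum, Finset.sum_mul]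
    exact Finset.sum_congr rfl fun i _ => Finset.sum_congr rfl fun j _ => by ring
  have htime (j : ι) : dirDeriv τ (dirDeriv (e j) F) p =
      ∑ i, dirDeriv (e j) (dirDeriv (e i) (dirDeriv (e i) F)) p +
        dirDeriv (e j) (gradSq e F) p := by
    rw [dirDeriv_comm hQ hF τ (e j) hp, dirDeriv_congr hQ heq (e j) hp,
      dirDeriv_add (DifferentiableAt.fun_sum fun i _ => dDD i) dG, dirDeriv_sum dDD]
  have hGt : dirDeriv τ (gradSq e F) p =
      2 * (∑ i, ∑ j, dirDeriv (e j) F p *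
        dirDeriv (e j) (dirDeriv (e i) (dirDeriv (e i) F)) p) + 4 * H := by
    rw [dirDeriv_gradSq hQ hF e τ hp, Finset.sum_comm]
    simp only [htime, mul_add, Finset.sum_add_distrib, Finset.mul_sum]
    congr 1
    rw [show 4 * H = 2 * (2 * H) by ring, ← hcross, Finset.mul_sum]
    exact Finset.sum_congr rfl fun i _ => by ring
  rw [dirDeriv_mul_inv_one_sub_sq dF dG (hne p hp), hGt, heq p hp]
  simp only [dirDeriv_dirDeriv_mul_inv_one_sub_sq hQ hF hG hne _ hp,
    dirDeriv_dirDeriv_gradSq hQ hF e _ hp]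
  simp only [Finset.sum_add_distrib, ← Finset.sum_mul, ← Finset.mul_sum, hcross]
  rw [show ∑ i, dirDeriv (e i) F p ^ 2 = gradSq e F p from rfl]
  ring

end Bochner

section Slices

variable {n : ℕ}

local notation "E" => EuclideanSpace ℝ (Fin n)

/-- The unit coordinate direction `i` of space, in space-time. -/
noncomputable def spaceDir (i : Fin n) : E × ℝ :=
  (EuclideanSpace.single i 1, 0)

/-- The unit time direction, in space-time. -/
noncomputable def timeDir : E × ℝ :=
  (0, 1)

theorem fderiv_slice {F : E × ℝ → ℝ} {x : E} {t : ℝ} (hF : DifferentiableAt ℝ F (x, t)) (v : E) :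
    fderiv ℝ (fun y => F (y, t)) x v = dirDeriv (v, (0 : ℝ)) F (x, t) := by
  have h : fderiv ℝ (fun y => F (y, t)) x = _ :=
    (hF.hasFDerivAt.comp x (hasFDerivAt_prodMk_left (𝕜 := ℝ) x t)).fderiv
  simp [dirDeriv, h]

theorem deriv_slice {F : E × ℝ → ℝ} {x : E} {t : ℝ} (hF : DifferentiableAt ℝ F (x, t)) :
    deriv (fun s => F (x, s)) t = dirDeriv timeDir F (x, t) := by
  have h : fderiv ℝ (fun s => F (x, s)) t = _ :=
    (hF.hasFDerivAt.comp t (hasFDerivAt_prodMk_right (𝕜 := ℝ) x t)).fderiv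
  simp [dirDeriv, timeDir, ← fderiv_apply_one_eq_deriv, h]

theorem eventually_slice_mem {Q : Set (E × ℝ)} (hQ : IsOpen Q) {x : E} {t : ℝ}
    (hp : (x, t) ∈ Q) : ∀ᶠ y in nhds x, (y, t) ∈ Q :=
  (Continuous.prodMk_left t).continuousAt.eventually (hQ.mem_nhds hp)

theorem shess_slice {Q : Set (E × ℝ)} (hQ : IsOpen Q) {F : E × ℝ → ℝ}
    (hF : ContDiffOn ℝ (⊤ : ℕ∞) F Q) {x : E} {t : ℝ} (hp : (x, t) ∈ Q) (i j : Fin n) :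
    shess (fun y => F (y, t)) x i j = dirDeriv (spaceDir i) (dirDeriv (spaceDir j) F) (x, t) := by
  have h : (fun y => fderiv ℝ (fun y => F (y, t)) y (EuclideanSpace.single j 1)) =ᶠ[nhds x]
      fun y => dirDeriv (spaceDir j) F (y, t) := by
    filter_upwards [eventually_slice_mem hQ hp] with y hy
    exact fderiv_slice (hF.differentiableAt_of_isOpen hQ hy) _
  rw [shess, h.fderiv_eq,
    fderiv_slice ((hF.dirDeriv hQ (spaceDir j)).differentiableAt_of_isOpen hQ hp)]
  rfl

theorem slap_slice {Q : Set (E × ℝ)} (hQ : IsOpen Q) {F : E × ℝ → ℝ}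
    (hF : ContDiffOn ℝ (⊤ : ℕ∞) F Q) {x : E} {t : ℝ} (hp : (x, t) ∈ Q) :
    slap (fun y => F (y, t)) x =
      ∑ i : Fin n, dirDeriv (spaceDir i) (dirDeriv (spaceDir i) F) (x, t) :=
  Finset.sum_congr rfl fun i _ => shess_slice hQ hF hp i i

theorem slap_congr {u v : E → ℝ} {x : E} (h : u =ᶠ[nhds x] v) : slap u x = slap v x := by
  refine Finset.sum_congr rfl fun i _ => ?_
  have h' : (fun y => fderiv ℝ u y (EuclideanSpace.single i 1)) =ᶠ[nhds x]
      fun y => fderiv ℝ v y (EuclideanSpace.single i 1) := by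
    filter_upwards [h.fderiv (𝕜 := ℝ)] with y hy
    rw [hy]
  rw [h'.fderiv_eq]

theorem sgrad_apply (u : E → ℝ) (x : E) (i : Fin n) :
    sgrad u x i = fderiv ℝ u x (EuclideanSpace.single i 1) := by
  have h : inner ℝ (gradient u x) (EuclideanSpace.single i (1 : ℝ)) =
      fderiv ℝ u x (EuclideanSpace.single i 1) := by
    simp [gradient, InnerProductSpace.toDual_symm_apply]
  rw [← h, EuclideanSpace.inner_single_right]
  simp [sgrad]

theorem sgrad_slice {F : E × ℝ → ℝ} {x : E} {t : ℝ} (hF : DifferentiableAt ℝ F (x, t))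
    (i : Fin n) : sgrad (fun y => F (y, t)) x i = dirDeriv (spaceDir i) F (x, t) := by
  rw [sgrad_apply, fderiv_slice hF]
  rfl

theorem norm_sgrad_slice_sq {F : E × ℝ → ℝ} {x : E} {t : ℝ}
    (hF : DifferentiableAt ℝ F (x, t)) :
    ‖sgrad (fun y => F (y, t)) x‖ ^ 2 = gradSq spaceDir F (x, t) := by
  simp only [EuclideanSpace.norm_sq_eq, Real.norm_eq_abs, sq_abs, sgrad_slice hF, gradSq]

end Slices

/-- The identity following (2.5), flat case (Bochner curvature term vanishes). -/
theorem bochner_identity_w (n : ℕ) (hn : 1 ≤ n)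
    (Q : Set (EuclideanSpace ℝ (Fin n) × ℝ)) (hQ : IsOpen Q)
    (f : EuclideanSpace ℝ (Fin n) → ℝ → ℝ)
    (hsmooth : ContDiffOn ℝ (⊤ : ℕ∞) (fun p : EuclideanSpace ℝ (Fin n) × ℝ => f p.1 p.2) Q)
    (heq : ∀ p ∈ Q,
      slap (fun y => f y p.2) p.1 + ‖sgrad (fun y => f y p.2) p.1‖ ^ 2 -
        deriv (fun s => f p.1 s) p.2 = 0)
    (hlt : ∀ p ∈ Q, f p.1 p.2 < 1)
    (w : EuclideanSpace ℝ (Fin n) → ℝ → ℝ)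
    (hw : w = fun x t => ‖sgrad (fun y => f y t) x‖ ^ 2 / (1 - f x t) ^ 2) :
    ∀ p ∈ Q,
      slap (fun y => w y p.2) p.1 - deriv (fun s => w p.1 s) p.2 =
        2 * (∑ i : Fin n, ∑ j : Fin n, (shess (fun y => f y p.2) p.1 i j) ^ 2) /
            (1 - f p.1 p.2) ^ 2 +
        6 * ‖sgrad (fun y => f y p.2) p.1‖ ^ 4 / (1 - f p.1 p.2) ^ 4 +
        8 * (∑ i : Fin n, ∑ j : Fin n,
              sgrad (fun y => f y p.2) p.1 i * shess (fun y => f y p.2) p.1 i j *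
                sgrad (fun y => f y p.2) p.1 j) / (1 - f p.1 p.2) ^ 3 -
        4 * (∑ i : Fin n, ∑ j : Fin n,
              sgrad (fun y => f y p.2) p.1 i * shess (fun y => f y p.2) p.1 i j *
                sgrad (fun y => f y p.2) p.1 j) / (1 - f p.1 p.2) ^ 2 -
        2 * ‖sgrad (fun y => f y p.2) p.1‖ ^ 4 / (1 - f p.1 p.2) ^ 3 := by
  obtain ⟨F, rfl⟩ : ∃ F : EuclideanSpace ℝ (Fin n) × ℝ → ℝ, f = fun x t => F (x, t) :=
    ⟨fun p => f p.1 p.2, rfl⟩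
  change ContDiffOn ℝ (⊤ : ℕ∞) F Q at hsmooth
  rintro ⟨x, t⟩ hp
  have hdiff {q} (hq : q ∈ Q) := hsmooth.differentiableAt_of_isOpen hQ hq
  have hne : ∀ q ∈ Q, 1 - F q ≠ 0 := fun q hq => (sub_pos.mpr (hlt q hq)).ne'
  have hevol : ∀ q ∈ Q, dirDeriv timeDir F q =
      ∑ i, dirDeriv (spaceDir i) (dirDeriv (spaceDir i) F) q + gradSq spaceDir F q := by
    rintro ⟨y, s⟩ hq
    rw [← slap_slice hQ hsmooth hq, ← norm_sgrad_slice_sq (hdiff hq), ← deriv_slice (hdiff hq)]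
    exact (sub_eq_zero.mp (heq _ hq)).symm
  set W : EuclideanSpace ℝ (Fin n) × ℝ → ℝ :=
    fun q => gradSq spaceDir F q * (1 - F q)⁻¹ ^ 2 with hWdef
  have hW : ContDiffOn ℝ (⊤ : ℕ∞) W Q :=
    (hsmooth.gradSq hQ spaceDir).mul (((contDiffOn_const.sub hsmooth).inv hne).pow 2)
  have hwW : ∀ q ∈ Q, w q.1 q.2 = W q := by
    rintro ⟨y, s⟩ hq
    rw [hw, hWdef]
    simp only [norm_sgrad_slice_sq (hdiff hq), div_eq_mul_inv, inv_pow]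
  have hspace : (fun y => w y t) =ᶠ[nhds x] fun y => W (y, t) := by
    exact (eventually_slice_mem hQ hp).mono fun y hy => hwW (y, t) hy
  have htime : (fun s => w x s) =ᶠ[nhds t] fun s => W (x, s) := by
    have hmem : ∀ᶠ s in nhds t, (x, s) ∈ Q :=
      (Continuous.prodMk_right x).continuousAt.eventually (hQ.mem_nhds hp)
    exact hmem.mono fun s hs => hwW (x, s) hs
  have hnorm_four : ‖sgrad (fun y => F (y, t)) x‖ ^ 4 = gradSq spaceDir F (x, t) ^ 2 := by
    rw [← norm_sgrad_slice_sq (hdiff hp)]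
    ring
  simp only [sgrad_slice (hdiff hp), shess_slice hQ hsmooth hp, hnorm_four, slap_congr hspace,
    htime.deriv_eq]
  rw [slap_slice hQ hW hp, deriv_slice (hW.differentiableAt_of_isOpen hQ hp),
    bochner_identity_dirDeriv hQ hsmooth hne spaceDir timeDir hevol hp]
  simp only [div_eq_mul_inv, inv_pow]
end

section
/- There exists a constant c > 0 depending only on the dimension n such that for every smooth positive harmonic function u on the open ball B(x₀, R) ⊂ ℝⁿ (i.e., Δu = 0 and u > 0 on B(x₀,R)), one has |∇u(x)|/u(x) ≤ c/R for all x ∈ B(x₀, R/2). (Euclidean, curvature-zero case of the Cheng–Yau gradient estimate (1.1) quoted in the introduction.) -/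
open Metric Set

/-- Necessary conditions of first and second order at a local maximum on the line. -/
theorem IsLocalMax.deriv_eq_zero_and_second_deriv_nonpos {h k : ℝ → ℝ} {c : ℝ}
    (hmax : IsLocalMax h 0) (hk : ∀ᶠ t in nhds 0, HasDerivAt h (k t) t)
    (hc : HasDerivAt k c 0) : k 0 = 0 ∧ c ≤ 0 := by
  have hderiv : deriv h =ᶠ[nhds 0] k := hk.mono fun t ht => ht.deriv
  have hk0 : k 0 = 0 := by
    rw [← hderiv.eq_of_nhds]
    exact hmax.deriv_eq_zero
  refine ⟨hk0, ?_⟩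
  by_contra! hpos
  have hdd : deriv (deriv h) 0 = c := by rw [hderiv.deriv_eq, hc.deriv]
  have hmin : IsLocalMin h 0 :=
    isLocalMin_of_deriv_deriv_pos (by rwa [hdd]) (by rw [hderiv.eq_of_nhds, hk0])
      hk.self_of_nhds.continuousAt
  have hconst : h =ᶠ[nhds 0] fun _ => h 0 := by
    filter_upwards [hmin, hmax] with t h₁ h₂ using le_antisymm h₂ h₁
  have : c = 0 := by
    rw [← hdd, hconst.deriv.deriv_eq]
    simp
  exact hpos.ne' this

/-- The partial derivative in the `i`-th coordinate direction. -/
noncomputable def partialDeriv {n : ℕ} (i : Fin n) (f : EuclideanSpace ℝ (Fin n) → ℝ) :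
    EuclideanSpace ℝ (Fin n) → ℝ :=
  fun y => fderiv ℝ f y (EuclideanSpace.single i 1)

section PartialDeriv

variable {n : ℕ} {f g : EuclideanSpace ℝ (Fin n) → ℝ} {s : Set (EuclideanSpace ℝ (Fin n))}
  {p : EuclideanSpace ℝ (Fin n)}

theorem ContDiffOn.partialDeriv (hf : ContDiffOn ℝ (⊤ : ℕ∞) f s) (hs : IsOpen s) (i : Fin n) :
    ContDiffOn ℝ (⊤ : ℕ∞) (partialDeriv i f) s :=
  (hf.fderiv_of_isOpen hs (by simp)).clm_apply contDiffOn_const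

theorem partialDeriv_congr (hs : IsOpen s) (h : EqOn f g s) (i : Fin n) :
    EqOn (partialDeriv i f) (partialDeriv i g) s := fun y hy => by
  have : f =ᶠ[nhds y] g := h.eventuallyEq_of_mem (hs.mem_nhds hy)
  simp only [partialDeriv, this.fderiv_eq]

theorem partialDeriv_comm (hf : ContDiffOn ℝ (⊤ : ℕ∞) f s) (hs : IsOpen s) (i j : Fin n) :
    EqOn (partialDeriv i (partialDeriv j f)) (partialDeriv j (partialDeriv i f)) s := by
  intro y hy
  have hfy : ContDiffAt ℝ (⊤ : ℕ∞) f y := hf.contDiffAt (hs.mem_nhds hy)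
  have hsymm : IsSymmSndFDerivAt ℝ f y :=
    hfy.isSymmSndFDerivAt (by
      rw [minSmoothness_of_isRCLikeNormedField]
      exact WithTop.coe_le_coe.2 (le_top : (2 : ℕ∞) ≤ ⊤))
  have hd : DifferentiableAt ℝ (fderiv ℝ f) y :=
    ((hf.fderiv_of_isOpen hs (m := (⊤ : ℕ∞)) (by simp)).contDiffAt (hs.mem_nhds hy)).differentiableAt
      (by simp)
  have key : ∀ v w : EuclideanSpace ℝ (Fin n),
      fderiv ℝ (fun z => fderiv ℝ f z v) y w = fderiv ℝ (fderiv ℝ f) y w v := by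
    intro v w
    rw [fderiv_clm_apply hd (differentiableAt_const v)]
    simp
  exact (key _ _).trans ((hsymm _ _).trans (key _ _).symm)

theorem hasDerivAt_line (hf : ContDiffOn ℝ (⊤ : ℕ∞) f s) (hs : IsOpen s) (j : Fin n) (t : ℝ)
    (ht : p + t • EuclideanSpace.single j (1 : ℝ) ∈ s) :
    HasDerivAt (fun t : ℝ => f (p + t • EuclideanSpace.single j (1 : ℝ)))
      (partialDeriv j f (p + t • EuclideanSpace.single j (1 : ℝ))) t := by
  have hd : DifferentiableAt ℝ f (p + t • EuclideanSpace.single j (1 : ℝ)) :=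
    (hf.contDiffAt (hs.mem_nhds ht)).differentiableAt (by simp)
  have hl : HasDerivAt (fun t : ℝ => p + t • EuclideanSpace.single j (1 : ℝ))
      (EuclideanSpace.single j (1 : ℝ)) t := by
    simpa using ((hasDerivAt_id t).smul_const (EuclideanSpace.single j (1 : ℝ))).const_add p
  exact hd.hasFDerivAt.comp_hasDerivAt t hl

/-- Partial derivatives of harmonic functions are harmonic. -/
theorem sum_partialDeriv_partialDeriv_partialDeriv (hf : ContDiffOn ℝ (⊤ : ℕ∞) f s)
    (hs : IsOpen s) (hlap : ∀ x ∈ s, slap f x = 0) (i : Fin n) (hp : p ∈ s) :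
    ∑ j, partialDeriv j (partialDeriv j (partialDeriv i f)) p = 0 := by
  have h₁ : ∀ j, partialDeriv j (partialDeriv j (partialDeriv i f)) p =
      partialDeriv i (partialDeriv j (partialDeriv j f)) p := fun j => by
    rw [partialDeriv_congr hs (partialDeriv_comm hf hs j i) j hp,
      partialDeriv_comm (hf.partialDeriv hs j) hs j i hp]
  have h₂ : EqOn (fun y => ∑ j, partialDeriv j (partialDeriv j f) y) (fun _ => 0) s := hlap
  have h₃ := partialDeriv_congr hs h₂ i hp
  have hd : ∀ j ∈ Finset.univ, DifferentiableAt ℝ (partialDeriv j (partialDeriv j f)) p :=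
    fun j _ => (((hf.partialDeriv hs j).partialDeriv hs j).contDiffAt
      (hs.mem_nhds hp)).differentiableAt (by simp)
  rw [partialDeriv, partialDeriv, fderiv_fun_sum hd] at h₃
  simp only [h₁]
  refine Eq.trans ?_ (h₃.trans (by simp))
  rw [sum_apply]
  rfl

theorem norm_sgrad_sq (f : EuclideanSpace ℝ (Fin n) → ℝ) (x : EuclideanSpace ℝ (Fin n)) :
    ‖sgrad f x‖ ^ 2 = ∑ i, partialDeriv i f x ^ 2 := by
  rw [EuclideanSpace.real_norm_sq_eq]
  refine Finset.sum_congr rfl fun i _ => ?_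
  have : partialDeriv i f x = inner ℝ (gradient f x) (EuclideanSpace.single i (1 : ℝ)) := by
    simp [partialDeriv, gradient]
  rw [this, EuclideanSpace.inner_single_right]
  simp [sgrad]

end PartialDeriv

/-- Derivatives of `φ² |∇u|² - M u²` along a coordinate line at a maximum. -/
theorem first_second_order_conditions {n : ℕ} {U : ℝ → ℝ} {G H : Fin n → ℝ → ℝ} {T : Fin n → ℝ}
    {φ : ℝ → ℝ} {ψ M : ℝ} (j : Fin n)
    (hφ : ∀ t, HasDerivAt φ (ψ - 2 * t) t)
    (hU : ∀ᶠ t in nhds 0, HasDerivAt U (G j t) t)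
    (hG : ∀ᶠ t in nhds 0, ∀ i, HasDerivAt (G i) (H i t) t)
    (hH : ∀ i, HasDerivAt (H i) (T i) 0)
    (hmax : IsLocalMax (fun t => φ t ^ 2 * ∑ i, G i t ^ 2 - M * U t ^ 2) 0) :
    φ 0 * ψ * ∑ i, G i 0 ^ 2 + φ 0 ^ 2 * ∑ i, G i 0 * H i 0 - M * U 0 * G j 0 = 0 ∧
    (ψ ^ 2 - 2 * φ 0) * ∑ i, G i 0 ^ 2 + 4 * φ 0 * ψ * ∑ i, G i 0 * H i 0 +
      φ 0 ^ 2 * ∑ i, (H i 0 ^ 2 + G i 0 * T i) - M * (G j 0 ^ 2 + U 0 * H j 0) ≤ 0 := by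
  have h₁ : ∀ᶠ t in nhds 0, HasDerivAt (fun t => φ t ^ 2 * ∑ i, G i t ^ 2 - M * U t ^ 2)
      (2 * (φ t * (ψ - 2 * t) * ∑ i, G i t ^ 2 + φ t ^ 2 * ∑ i, G i t * H i t
        - M * (U t * G j t))) t := by
    filter_upwards [hU, hG] with t hUt hGt
    have hsum : HasDerivAt (fun t => ∑ i, G i t ^ 2) (∑ i, 2 * (G i t * H i t)) t :=
      HasDerivAt.fun_sum fun i _ => by
        refine ((hGt i).pow 2).congr_deriv ?_
        push_cast; ring
    refine ((((hφ t).pow 2).mul hsum).sub ((hUt.pow 2).const_mul M)).congr_deriv ?_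
    rw [← Finset.mul_sum]
    simp only [Pi.pow_apply]
    push_cast; ring
  have hG0 := hG.self_of_nhds
  have h₂ : HasDerivAt (fun t => 2 * (φ t * (ψ - 2 * t) * ∑ i, G i t ^ 2
        + φ t ^ 2 * ∑ i, G i t * H i t - M * (U t * G j t)))
      (2 * ((ψ ^ 2 - 2 * φ 0) * ∑ i, G i 0 ^ 2 + 4 * φ 0 * ψ * ∑ i, G i 0 * H i 0 +
      φ 0 ^ 2 * ∑ i, (H i 0 ^ 2 + G i 0 * T i) - M * (G j 0 ^ 2 + U 0 * H j 0))) 0 := by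
    have hsum : HasDerivAt (fun t => ∑ i, G i t ^ 2) (∑ i, 2 * (G i 0 * H i 0)) 0 :=
      HasDerivAt.fun_sum fun i _ => by
        refine ((hG0 i).pow 2).congr_deriv ?_
        push_cast; ring
    have hsum' : HasDerivAt (fun t => ∑ i, G i t * H i t)
        (∑ i, (H i 0 ^ 2 + G i 0 * T i)) 0 :=
      HasDerivAt.fun_sum fun i _ => by
        refine ((hG0 i).mul (hH i)).congr_deriv ?_
        ring
    have hψ : HasDerivAt (fun t : ℝ => ψ - 2 * t) (-2) 0 := by
      simpa using ((hasDerivAt_id (0 : ℝ)).const_mul 2).const_sub ψ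
    refine ((((((hφ 0).mul hψ).mul hsum).add (((hφ 0).pow 2).mul hsum')).sub
      ((hU.self_of_nhds.mul (hG0 j)).const_mul M)).const_mul 2).congr_deriv ?_
    rw [← Finset.mul_sum]
    simp only [Pi.pow_apply, Pi.mul_apply]
    push_cast; ring
  obtain ⟨h0, hc⟩ := hmax.deriv_eq_zero_and_second_deriv_nonpos h₁ h₂
  constructor
  · simp only [mul_zero, sub_zero] at h0
    linarith
  · linarith

/-- A trace bound for `u D² log u`. -/
theorem sq_sum_sq_div_le_card_mul_sum {n : ℕ} {u : ℝ} (hu : 0 < u) {a : Fin n → ℝ}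
    {h : Fin n → Fin n → ℝ} (htr : ∑ i, h i i = 0) :
    (∑ i, a i ^ 2) ^ 2 / u ^ 2 ≤ n * (∑ j, ∑ i, h i j ^ 2
      - 2 / u * ∑ j, a j * ∑ i, a i * h i j + (∑ i, a i ^ 2) ^ 2 / u ^ 2) := by
  have h₁ : (∑ i, a i ^ 2) ^ 2 / u ^ 2 = (∑ i, (h i i - a i * a i / u)) ^ 2 := by
    rw [Finset.sum_sub_distrib, htr, ← Finset.sum_div]
    simp only [← sq]
    ring
  have h₂ : (∑ i, (h i i - a i * a i / u)) ^ 2 ≤ n * ∑ i, (h i i - a i * a i / u) ^ 2 := by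
    simpa using sq_sum_le_card_mul_sum_sq (s := Finset.univ) (f := fun i => h i i - a i * a i / u)
  have h₃ : ∑ i, (h i i - a i * a i / u) ^ 2 ≤ ∑ j, ∑ i, (h i j - a i * a j / u) ^ 2 :=
    Finset.sum_le_sum fun j _ => Finset.single_le_sum
      (f := fun i => (h i j - a i * a j / u) ^ 2) (fun i _ => sq_nonneg _) (Finset.mem_univ j)
  have h₄ : ∑ j, ∑ i, (h i j - a i * a j / u) ^ 2 = ∑ j, ∑ i, h i j ^ 2
      - 2 / u * ∑ j, a j * ∑ i, a i * h i j + (∑ i, a i ^ 2) ^ 2 / u ^ 2 := by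
    rw [sq (∑ i, a i ^ 2), Finset.sum_mul_sum, Finset.mul_sum, Finset.sum_div,
      ← Finset.sum_sub_distrib, ← Finset.sum_add_distrib]
    refine Finset.sum_congr rfl fun j _ => ?_
    rw [Finset.mul_sum, Finset.mul_sum, Finset.sum_div, ← Finset.sum_sub_distrib,
      ← Finset.sum_add_distrib]
    refine Finset.sum_congr rfl fun i _ => ?_
    field_simp
    ring
  rw [h₁]
  rw [h₁] at h₄
  rw [← h₄]
  exact h₂.trans (mul_le_mul_of_nonneg_left h₃ (Nat.cast_nonneg n))

/-- The pointwise bound extracted from the maximum conditions. -/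
theorem bound_of_maximum_conditions {n : ℕ} (hn : 1 ≤ n) {u φ r : ℝ} (hu : 0 < u) (hφ : 0 < φ)
    (hr : 0 < r) (hφr : φ ≤ r ^ 2) {a ψ : Fin n → ℝ} {h T : Fin n → Fin n → ℝ}
    (hg : 0 < ∑ i, a i ^ 2) (hψ : ∑ j, ψ j ^ 2 ≤ 4 * r ^ 2)
    (htr : ∑ i, h i i = 0) (hT : ∀ i, ∑ j, T i j = 0)
    (hfirst : ∀ j, φ * ψ j * ∑ i, a i ^ 2 + φ ^ 2 * ∑ i, a i * h i j
      - φ ^ 2 * (∑ i, a i ^ 2) / u ^ 2 * u * a j = 0)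
    (hsecond : ∀ j, (ψ j ^ 2 - 2 * φ) * ∑ i, a i ^ 2 + 4 * φ * ψ j * ∑ i, a i * h i j +
      φ ^ 2 * ∑ i, (h i j ^ 2 + a i * T i j)
      - φ ^ 2 * (∑ i, a i ^ 2) / u ^ 2 * (a j ^ 2 + u * h j j) ≤ 0) :
    φ ^ 2 * (∑ i, a i ^ 2) / u ^ 2 ≤ (10 * n * r) ^ 2 := by
  have hkato := sq_sum_sq_div_le_card_mul_sum (a := a) hu htr
  have hcs : (∑ j, ψ j * a j) ^ 2 ≤ (∑ j, ψ j ^ 2) * ∑ j, a j ^ 2 :=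
    Finset.sum_mul_sq_le_sq_mul_sq _ _ _
  have hsum := Finset.sum_nonpos fun j (_ : j ∈ Finset.univ) => hsecond j
  set g := ∑ i, a i ^ 2 with hgdef
  set P := ∑ j, ψ j ^ 2 with hPdef
  set Q := ∑ j, ψ j * a j with hQdef
  have hb : ∀ j, ∑ i, a i * h i j = g / u * a j - g / φ * ψ j := fun j => by
    have := hfirst j
    have hφ2 : φ ^ 2 * (∑ i, a i * h i j) = φ ^ 2 * (g / u * a j - g / φ * ψ j) := by
      have e : φ ^ 2 * (g / u * a j - g / φ * ψ j) =
        φ ^ 2 * g / u ^ 2 * u * a j - φ * ψ j * g := by field_simp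
      rw [e]; linarith
    exact mul_left_cancel₀ (by positivity) hφ2
  have hTT : ∑ j, ∑ i, a i * T i j = 0 := by
    rw [Finset.sum_comm]
    simp [← Finset.mul_sum, hT]
  have e₁ : ∑ j, a j * ∑ i, a i * h i j = g ^ 2 / u - g / φ * Q := by
    have : ∀ j, a j * ∑ i, a i * h i j = g / u * a j ^ 2 - g / φ * (ψ j * a j) := fun j => by
      rw [hb]; ring
    simp only [this, Finset.sum_sub_distrib, ← Finset.mul_sum, ← hgdef, ← hQdef]
    ring
  have e₂ : ∑ j, 4 * φ * ψ j * ∑ i, a i * h i j = 4 * φ * (g / u * Q - g / φ * P) := by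
    have : ∀ j, 4 * φ * ψ j * ∑ i, a i * h i j
        = 4 * φ * (g / u) * (ψ j * a j) - 4 * φ * (g / φ) * ψ j ^ 2 := fun j => by
      rw [hb]; ring
    simp only [this, Finset.sum_sub_distrib, ← Finset.mul_sum, ← hPdef, ← hQdef]
    ring
  set S := ∑ j, ∑ i, h i j ^ 2 with hSdef
  rw [Finset.sum_sub_distrib, Finset.sum_add_distrib, Finset.sum_add_distrib, e₂,
    ← Finset.sum_mul, ← Finset.mul_sum, ← Finset.mul_sum, Finset.sum_add_distrib,
    ← Finset.mul_sum, htr, Finset.sum_sub_distrib, ← hPdef, ← hgdef] at hsum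
  simp only [Finset.sum_add_distrib, hTT, ← hSdef, Finset.sum_const, Finset.card_univ,
    Fintype.card_fin, nsmul_eq_mul, mul_zero, add_zero] at hsum
  rw [e₁] at hkato
  have hn' : (1 : ℝ) ≤ n := by exact_mod_cast hn
  set N : ℝ := (n : ℝ)
  obtain ⟨q, hq0, hq⟩ : ∃ q : ℝ, 0 < q ∧ g = q ^ 2 :=
    ⟨√g, Real.sqrt_pos.2 hg, (Real.sq_sqrt hg.le).symm⟩
  -- `m` plays the role of `φ |∇ log u|`
  obtain ⟨m, hm⟩ : ∃ m, m = φ * q / u := ⟨_, rfl⟩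
  have hm0 : 0 < m := by rw [hm]; positivity
  have hgoal : φ ^ 2 * g / u ^ 2 = m ^ 2 := by rw [hm, hq]; field_simp
  have hQ : -(2 * r * q) ≤ Q := by
    have : Q ^ 2 ≤ (2 * r * q) ^ 2 := by
      calc Q ^ 2 ≤ P * g := hcs
        _ ≤ 4 * r ^ 2 * g := by gcongr
        _ = (2 * r * q) ^ 2 := by rw [hq]; ring
    exact (abs_le.1 (abs_le_of_sq_le_sq this (by positivity))).1
  have hkey : m ^ 2 ≤ N * (4 * r * m + 12 * r ^ 2 + 2 * N * r ^ 2) := by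
    have hk2 : m ^ 2 * g ≤ N * (φ ^ 2 * S - m ^ 2 * g + 2 * φ / u * g * Q) := by
      have := mul_le_mul_of_nonneg_left hkato (sq_nonneg φ)
      rw [← hgoal]
      calc φ ^ 2 * g / u ^ 2 * g = φ ^ 2 * (g ^ 2 / u ^ 2) := by ring
        _ ≤ _ := this
        _ = _ := by field_simp; ring
    have hs2 : φ ^ 2 * S - m ^ 2 * g + 2 * φ / u * g * Q
        ≤ g * (3 * P + 2 * N * φ - 2 * φ / u * Q) := by
      rw [hgoal] at hsum
      have : 4 * φ * (g / u * Q - g / φ * P) = 4 * φ / u * g * Q - 4 * g * P := by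
        field_simp
      rw [this] at hsum
      have e : 4 * φ / u * g * Q = 2 * (2 * φ / u * g * Q) := by ring
      have e' : g * (3 * P + 2 * N * φ - 2 * φ / u * Q) =
        3 * g * P + 2 * N * φ * g - 2 * φ / u * g * Q := by ring
      rw [e']
      rw [e] at hsum
      linarith
    have hs3 : 3 * P + 2 * N * φ - 2 * φ / u * Q ≤ 4 * r * m + 12 * r ^ 2 + 2 * N * r ^ 2 := by
      have : 2 * φ / u * -(2 * r * q) ≤ 2 * φ / u * Q := by gcongr
      have e : 2 * φ / u * -(2 * r * q) = -(4 * r * m) := by rw [hm]; ring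
      have : 2 * N * φ ≤ 2 * N * r ^ 2 := by gcongr
      linarith
    have : g * m ^ 2 ≤ g * (N * (4 * r * m + 12 * r ^ 2 + 2 * N * r ^ 2)) := by
      calc g * m ^ 2 = m ^ 2 * g := mul_comm _ _
        _ ≤ _ := hk2
        _ ≤ N * (g * (3 * P + 2 * N * φ - 2 * φ / u * Q)) := by gcongr
        _ ≤ N * (g * (4 * r * m + 12 * r ^ 2 + 2 * N * r ^ 2)) := by gcongr
        _ = _ := by ring
    exact le_of_mul_le_mul_left this hg
  rw [hgoal]
  have hmr : m ≤ 10 * N * r := by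
    by_contra! hlt
    have h₁ : 10 * N * r * m < m * m := by gcongr
    have h₂ : 6 * N * r * (10 * N * r) ≤ 6 * N * r * m := by gcongr
    have h₃ : N * r ^ 2 ≤ N * N * r ^ 2 := by
      have : N * 1 ≤ N * N := by gcongr
      nlinarith [sq_nonneg r]
    nlinarith [sq_nonneg (N * r)]
  gcongr

/-- Interior bound for `(r² - |x - x₀|²) |∇ log u|` via the maximum principle. -/
theorem weighted_log_gradient_bound {n : ℕ} (hn : 1 ≤ n) {x₀ : EuclideanSpace ℝ (Fin n)}
    {R r : ℝ} (hr : 0 < r) (hrR : r < R) {u : EuclideanSpace ℝ (Fin n) → ℝ}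
    (hu : ContDiffOn ℝ (⊤ : ℕ∞) u (ball x₀ R))
    (hlap : ∀ x ∈ ball x₀ R, slap u x = 0) (hpos : ∀ x ∈ ball x₀ R, 0 < u x)
    {x : EuclideanSpace ℝ (Fin n)} (hx : x ∈ closedBall x₀ r) :
    (r ^ 2 - ‖x - x₀‖ ^ 2) ^ 2 * (∑ i, partialDeriv i u x ^ 2) / u x ^ 2
      ≤ (10 * n * r) ^ 2 := by
  have hsub : closedBall x₀ r ⊆ ball x₀ R := closedBall_subset_ball hrR
  have ho : IsOpen (ball x₀ R) := isOpen_ball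
  have hcont : ContinuousOn (fun x => (r ^ 2 - ‖x - x₀‖ ^ 2) ^ 2 *
      (∑ i, partialDeriv i u x ^ 2) / u x ^ 2) (closedBall x₀ r) := by
    refine ContinuousOn.div (ContinuousOn.mul (by fun_prop) ?_) ?_ ?_
    · exact continuousOn_finsetSum _ fun i _ =>
        (((hu.partialDeriv ho i).continuousOn).mono hsub).pow 2
    · exact (hu.continuousOn.mono hsub).pow 2
    · exact fun y hy => (pow_pos (hpos y (hsub hy)) 2).ne'
  obtain ⟨p, hp, hmax⟩ := (isCompact_closedBall x₀ r).exists_isMaxOn ⟨x, hx⟩ hcont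
  refine (hmax hx).trans ?_
  set M := (r ^ 2 - ‖p - x₀‖ ^ 2) ^ 2 * (∑ i, partialDeriv i u p ^ 2) / u p ^ 2 with hM
  simp only
  have hup : 0 < u p := hpos p (hsub hp)
  have hdist : ‖p - x₀‖ ≤ r := by simpa [dist_eq_norm] using hp
  rcases (by positivity : 0 ≤ M).eq_or_lt with hM0 | hM0
  · rw [← hM, ← hM0]; positivity
  have hφ0 : 0 < r ^ 2 - ‖p - x₀‖ ^ 2 := by
    have h0 : r ^ 2 - ‖p - x₀‖ ^ 2 ≠ 0 := fun h => by simp [hM, h] at hM0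
    have : 0 ≤ r ^ 2 - ‖p - x₀‖ ^ 2 := sub_nonneg.2 (by gcongr)
    exact lt_of_le_of_ne this h0.symm
  have hg0 : 0 < ∑ i, partialDeriv i u p ^ 2 := by
    have h0 : ∑ i, partialDeriv i u p ^ 2 ≠ 0 := fun h => by simp [hM, h] at hM0
    exact lt_of_le_of_ne (by positivity) h0.symm
  have hpball : p ∈ ball x₀ r := by
    rw [mem_ball, dist_eq_norm]
    by_contra! h
    have : r ^ 2 ≤ ‖p - x₀‖ ^ 2 := by gcongr
    linarith
  have hpR : p ∈ ball x₀ R := hsub hp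
  have hHle : ∀ y ∈ closedBall x₀ r,
      (r ^ 2 - ‖y - x₀‖ ^ 2) ^ 2 * (∑ i, partialDeriv i u y ^ 2) - M * u y ^ 2 ≤ 0 := by
    intro y hy
    have h₁ : (r ^ 2 - ‖y - x₀‖ ^ 2) ^ 2 * (∑ i, partialDeriv i u y ^ 2) / u y ^ 2 ≤ M := hmax hy
    have h₂ : 0 < u y ^ 2 := pow_pos (hpos y (hsub hy)) 2
    have := (div_le_iff₀ h₂).1 h₁
    linarith
  have hHp : (r ^ 2 - ‖p - x₀‖ ^ 2) ^ 2 * (∑ i, partialDeriv i u p ^ 2) - M * u p ^ 2 = 0 := by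
    rw [hM]; field_simp; ring
  have hline : ∀ j : Fin n, Filter.Tendsto
      (fun t : ℝ => p + t • EuclideanSpace.single j (1 : ℝ)) (nhds 0) (nhds p) := fun j => by
    have : Continuous (fun t : ℝ => p + t • EuclideanSpace.single j (1 : ℝ)) := by fun_prop
    simpa using this.tendsto 0
  have hcond := fun j : Fin n => first_second_order_conditions
    (U := fun t => u (p + t • EuclideanSpace.single j (1 : ℝ)))
    (G := fun i t => partialDeriv i u (p + t • EuclideanSpace.single j (1 : ℝ)))
    (H := fun i t => partialDeriv j (partialDeriv i u) (p + t • EuclideanSpace.single j (1 : ℝ)))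
    (T := fun i => partialDeriv j (partialDeriv j (partialDeriv i u)) p)
    (φ := fun t => r ^ 2 - ‖p + t • EuclideanSpace.single j (1 : ℝ) - x₀‖ ^ 2)
    (ψ := -2 * (p - x₀) j) (M := M) j
    (fun t => by
      have : ∀ t : ℝ, r ^ 2 - ‖p + t • EuclideanSpace.single j (1 : ℝ) - x₀‖ ^ 2 =
          r ^ 2 - ‖p - x₀‖ ^ 2 + (-2 * (p - x₀) j * t - t ^ 2) := fun t => by
        rw [show p + t • EuclideanSpace.single j (1 : ℝ) - x₀ =
          (p - x₀) + t • EuclideanSpace.single j (1 : ℝ) by abel, norm_add_sq_real,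
          inner_smul_right, EuclideanSpace.inner_single_right, norm_smul]
        simp
        ring
      simp only [this]
      refine ((((hasDerivAt_id t).const_mul (-2 * (p - x₀) j)).sub
        ((hasDerivAt_id t).pow 2)).const_add (r ^ 2 - ‖p - x₀‖ ^ 2)).congr_deriv ?_
      simp)
    (by
      filter_upwards [(hline j).eventually (ho.mem_nhds hpR)] with t ht
      exact hasDerivAt_line hu ho j t ht)
    (by
      filter_upwards [(hline j).eventually (ho.mem_nhds hpR)] with t ht i
      exact hasDerivAt_line (hu.partialDeriv ho i) ho j t ht)
    (fun i => by
      simpa using hasDerivAt_line (p := p) ((hu.partialDeriv ho i).partialDeriv ho j) ho j 0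
        (by simpa using hpR))
    (by
      filter_upwards [(hline j).eventually (isOpen_ball.mem_nhds hpball)] with t ht
      simpa [hHp] using hHle _ (ball_subset_closedBall ht))
  simp only [zero_smul, add_zero] at hcond
  refine bound_of_maximum_conditions hn hup hφ0 hr (by nlinarith [sq_nonneg ‖p - x₀‖])
    (ψ := fun j => -2 * (p - x₀) j)
    (h := fun i j => partialDeriv j (partialDeriv i u) p)
    (T := fun i j => partialDeriv j (partialDeriv j (partialDeriv i u)) p) hg0 ?_
    (hlap p hpR) (fun i => sum_partialDeriv_partialDeriv_partialDeriv hu ho hlap i hpR)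
    (fun j => (hcond j).1) (fun j => (hcond j).2)
  simp only [mul_pow, ← Finset.mul_sum, ← EuclideanSpace.real_norm_sq_eq]
  norm_num
  gcongr

/-- Euclidean, curvature-zero case of the Cheng–Yau gradient estimate (1.1). -/
theorem cheng_yau_gradient_estimate (n : ℕ) (hn : 1 ≤ n) :
    ∃ c : ℝ, 0 < c ∧
      ∀ (x₀ : EuclideanSpace ℝ (Fin n)) (R : ℝ), 0 < R →
      ∀ u : EuclideanSpace ℝ (Fin n) → ℝ,
        ContDiffOn ℝ (⊤ : ℕ∞) u (ball x₀ R) →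
        (∀ x ∈ ball x₀ R, slap u x = 0 ∧ 0 < u x) →
        ∀ x ∈ ball x₀ (R / 2), ‖sgrad u x‖ / u x ≤ c / R := by
  have hn' : (0 : ℝ) < n := by exact_mod_cast hn
  refine ⟨24 * n, by positivity, fun x₀ R hR u hu hlu x hx => ?_⟩
  have hxd : ‖x - x₀‖ < R / 2 := by simpa [dist_eq_norm] using hx
  have hux : 0 < u x := (hlu x (ball_subset_ball (by linarith) hx)).2
  have hbound := weighted_log_gradient_bound hn (r := 3 * R / 4) (by positivity) (by linarith) hu
    (fun y hy => (hlu y hy).1) (fun y hy => (hlu y hy).2)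
    (closedBall_subset_closedBall (by linarith) (ball_subset_closedBall hx))
  rw [← norm_sgrad_sq] at hbound
  have hφ : 5 / 16 * R ^ 2 ≤ (3 * R / 4) ^ 2 - ‖x - x₀‖ ^ 2 := by
    have : ‖x - x₀‖ ^ 2 ≤ (R / 2) ^ 2 := by gcongr
    linarith
  set φ := (3 * R / 4) ^ 2 - ‖x - x₀‖ ^ 2
  have hle : φ * (‖sgrad u x‖ / u x) ≤ 10 * n * (3 * R / 4) := by
    refine le_of_sq_le_sq ?_ (by positivity)
    calc (φ * (‖sgrad u x‖ / u x)) ^ 2 = φ ^ 2 * ‖sgrad u x‖ ^ 2 / u x ^ 2 := by ring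
      _ ≤ _ := hbound
  have hle' : 5 / 16 * R ^ 2 * (‖sgrad u x‖ / u x) ≤ 10 * n * (3 * R / 4) :=
    (mul_le_mul_of_nonneg_right hφ (by positivity)).trans hle
  rw [le_div_iff₀ hR]
  refine le_of_mul_le_mul_left ?_ (by positivity : 0 < 5 / 16 * R)
  calc 5 / 16 * R * (‖sgrad u x‖ / u x * R) = 5 / 16 * R ^ 2 * (‖sgrad u x‖ / u x) := by ring
    _ ≤ _ := hle'
    _ = _ := by ring
end
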